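/- arXiv:quant-ph/0408119 — 7 statements merged into one kernel-verified Lean document; each statement's English description precedes it below -/
import Mathlib

section
/- Let l ≥ 1 and let a, b ∈ X = (Fin l → ZMod 2) with a ≠ b. Let ψ be the state (δ_a + δ_b)/√2. Then for every z ∈ X, the full Hadamard transform satisfies (W_{Fin l} ψ)(z) = 2^{-(l-1)/2} · (−1)^{a·z} if a·z = b·z, and (W_{Fin l} ψ)(z) = 0 if a·z ≠ b·z. In particular, W_{Fin l} ψ is supported on exactly the 2^{l−1} basis states z with a·z = b·z. -/
open Finset

/-- The partial Hadamard transform on the qubits in `T`. -/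
noncomputable def Wt {l : ℕ} (T : Finset (Fin l)) (ψ : (Fin l → ZMod 2) → ℂ) :
    (Fin l → ZMod 2) → ℂ := fun z =>
  ((((2 : ℝ) ^ (-(T.card : ℝ) / 2) : ℝ) : ℂ)) *
    ∑ w ∈ Finset.univ.filter (fun w : Fin l → ZMod 2 => ∀ j ∉ T, w j = z j),
      (-1 : ℂ) ^ (∑ j ∈ T, z j * w j : ZMod 2).val * ψ w

/-- The mod-2 dot product. -/
def dotp {l : ℕ} (a z : Fin l → ZMod 2) : ZMod 2 := ∑ j, a j * z j

theorem aux_W {l : ℕ} (a b : Fin l → ZMod 2)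
    (ψ : (Fin l → ZMod 2) → ℂ)
    (hψ : ∀ z, ψ z = ((if z = a then 1 else 0) + (if z = b then 1 else 0)) /
      ((Real.sqrt 2 : ℝ) : ℂ)) (z : Fin l → ZMod 2) :
    Wt Finset.univ ψ z = ((((2 : ℝ) ^ (-(l : ℝ) / 2) : ℝ) : ℂ)) *
      (((-1) ^ (dotp a z).val + (-1) ^ (dotp b z).val) / ((Real.sqrt 2 : ℝ) : ℂ)) := by
  have h : ∀ w, (∑ j, z j * w j) = dotp w z := by
    intro w
    unfold dotp
    exact Finset.sum_congr rfl (fun j _ => mul_comm _ _)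
  unfold Wt
  simp only [h, hψ, Finset.card_univ, Fintype.card_fin]
  congr 1
  simp [mul_div_assoc', mul_add, ← Finset.sum_div, Finset.sum_add_distrib]

theorem aux_sign : ∀ x y : ZMod 2, x ≠ y → ((-1 : ℂ) ^ x.val + (-1) ^ y.val = 0) := by
  intro x y h
  have hv : ∀ x y : ZMod 2, x ≠ y → (x.val = 0 ∧ y.val = 1) ∨ (x.val = 1 ∧ y.val = 0) := by
    decide
  rcases hv x y h with ⟨h1, h2⟩ | ⟨h1, h2⟩ <;> simp [h1, h2]

theorem aux_pow (l : ℕ) : (2 : ℝ) ^ (-(l : ℝ) / 2) * (2 / Real.sqrt 2)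
    = (2 : ℝ) ^ (-((l : ℝ) - 1) / 2) := by
  rw [Real.div_sqrt, Real.sqrt_eq_rpow, ← Real.rpow_add (by norm_num)]
  congr 1
  ring

theorem aux_flip : ∀ x y p q : ZMod 2, p ≠ q → (x = y ↔ ¬ (x + p = y + q)) := by decide

theorem aux_card {l : ℕ} (hl : 1 ≤ l) (a b : Fin l → ZMod 2) (hab : a ≠ b) :
    (Finset.univ.filter (fun z : Fin l → ZMod 2 => dotp a z = dotp b z)).card
        = 2 ^ (l - 1) := by
  obtain ⟨j, hj⟩ := Function.ne_iff.mp hab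
  have hd : ∀ (c z : Fin l → ZMod 2), dotp c (z + Pi.single j 1) = dotp c z + c j := by
    intro c z
    simp [dotp, mul_add, Finset.sum_add_distrib, Pi.single_apply]
  have h1 : (Finset.univ.filter (fun z : Fin l → ZMod 2 => dotp a z = dotp b z)).card
      = (Finset.univ.filter (fun z : Fin l → ZMod 2 => ¬ dotp a z = dotp b z)).card := by
    refine Finset.card_equiv (Equiv.addRight (Pi.single j 1)) ?_
    intro z
    simp only [Finset.mem_filter, Finset.mem_univ, true_and, Equiv.coe_addRight, hd]
    exact aux_flip _ _ _ _ hj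
  have h2 := Finset.card_filter_add_card_filter_not (s := (Finset.univ : Finset (Fin l → ZMod 2)))
    (fun z => dotp a z = dotp b z)
  rw [← h1] at h2
  have h3 : (Finset.univ : Finset (Fin l → ZMod 2)).card = 2 ^ l := by
    simp [Finset.card_univ, ZMod.card]
  obtain ⟨m, rfl⟩ : ∃ m, l = m + 1 := ⟨l - 1, by omega⟩
  rw [h3, pow_succ] at h2
  simp only [Nat.add_sub_cancel]
  omega

theorem stmt0 {l : ℕ} (hl : 1 ≤ l) (a b : Fin l → ZMod 2) (hab : a ≠ b)
    (ψ : (Fin l → ZMod 2) → ℂ)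
    (hψ : ∀ z, ψ z = ((if z = a then 1 else 0) + (if z = b then 1 else 0)) /
      ((Real.sqrt 2 : ℝ) : ℂ)) :
    (∀ z : Fin l → ZMod 2,
      (dotp a z = dotp b z →
        Wt Finset.univ ψ z
          = ((((2 : ℝ) ^ (-((l : ℝ) - 1) / 2) : ℝ) : ℂ)) * (-1) ^ (dotp a z).val)
      ∧ (dotp a z ≠ dotp b z → Wt Finset.univ ψ z = 0))
    ∧ (∀ z : Fin l → ZMod 2, Wt Finset.univ ψ z ≠ 0 ↔ dotp a z = dotp b z)
    ∧ (Finset.univ.filter (fun z : Fin l → ZMod 2 => dotp a z = dotp b z)).card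
        = 2 ^ (l - 1) := by
  have H1 : ∀ z : Fin l → ZMod 2, dotp a z = dotp b z → Wt Finset.univ ψ z
          = ((((2 : ℝ) ^ (-((l : ℝ) - 1) / 2) : ℝ) : ℂ)) * (-1) ^ (dotp a z).val := by
    intro z h
    rw [aux_W a b ψ hψ z, ← h, ← aux_pow]
    push_cast
    ring
  have H2 : ∀ z : Fin l → ZMod 2, dotp a z ≠ dotp b z → Wt Finset.univ ψ z = 0 := by
    intro z h
    rw [aux_W a b ψ hψ z, aux_sign _ _ h]
    simp
  refine ⟨fun z => ⟨H1 z, H2 z⟩, fun z => ⟨fun h => ?_, fun h => ?_⟩, aux_card hl a b hab⟩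
  · by_contra hne
    exact h (H2 z hne)
  · rw [H1 z h]
    refine mul_ne_zero ?_ (pow_ne_zero _ (by norm_num))
    exact_mod_cast (Real.rpow_pos_of_pos (by norm_num) _).ne'
end

section
/- Let l ≥ 1, let a, b ∈ X = (Fin l → ZMod 2), and let i : Fin l with a i ≠ b i. Let ψ be the state (δ_a + δ_b)/√2 and let T = (Fin l) \ {i}. Then for every z ∈ X, |(W_T ψ)(z)|² = 2^{−l}; in particular, W_T ψ assigns nonzero amplitude to all 2^l basis states. -/
open Finset

theorem stmt1 {l : ℕ} (hl : 1 ≤ l) (a b : Fin l → ZMod 2) (i : Fin l)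
    (hi : a i ≠ b i) (ψ : (Fin l → ZMod 2) → ℂ)
    (hψ : ∀ z, ψ z = ((if z = a then 1 else 0) + (if z = b then 1 else 0)) /
      ((Real.sqrt 2 : ℝ) : ℂ)) :
    (∀ z : Fin l → ZMod 2,
        ‖Wt (Finset.univ \ {i}) ψ z‖ ^ 2 = (2 : ℝ) ^ (-(l : ℝ)))
    ∧ (∀ z : Fin l → ZMod 2, Wt (Finset.univ \ {i}) ψ z ≠ 0) := by
  have key : ∀ z : Fin l → ZMod 2,
      ‖Wt (Finset.univ \ {i}) ψ z‖ ^ 2 = (2 : ℝ) ^ (-(l : ℝ)) := by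
    intro z
    have hsum : ∀ c d : Fin l → ZMod 2, c i = z i → d i ≠ z i →
        (∀ w, ψ w = ((if w = c then 1 else 0) + (if w = d then 1 else 0)) /
          ((Real.sqrt 2 : ℝ) : ℂ)) →
        ‖Wt (Finset.univ \ {i}) ψ z‖ ^ 2 = (2 : ℝ) ^ (-(l : ℝ)) := by
      intro c d hc hd hw
      have hcd : c ≠ d := by
        rintro rfl
        exact hd hc
      unfold Wt
      rw [Finset.sum_eq_single c]
      · have hcard : (((Finset.univ \ {i} : Finset (Fin l)).card : ℕ) : ℝ) = (l : ℝ) - 1 := by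
          rw [← Finset.compl_eq_univ_sdiff, Finset.card_compl]
          simp [Nat.cast_sub hl]
        rw [hcard, hw c]
        simp only [if_true, if_neg hcd, add_zero, norm_mul, norm_pow, norm_neg, norm_one,
          one_pow, one_mul, norm_div, Complex.norm_real, mul_pow, div_pow, Real.norm_eq_abs,
          sq_abs]
        rw [Real.sq_sqrt (by norm_num), ← Real.rpow_natCast, ← Real.rpow_mul (by norm_num)]
        have : -((l : ℝ) - 1) / 2 * ((2 : ℕ) : ℝ) = -(l : ℝ) + 1 := by
          push_cast
          ring
        rw [this, Real.rpow_add (by norm_num), Real.rpow_one]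
        ring
      · intro w hwm hwc
        have hwd : w ≠ d := by
          rintro rfl
          exact hd ((Finset.mem_filter.mp hwm).2 i (by simp))
        rw [hw w, if_neg hwc, if_neg hwd]
        simp
      · intro h
        exfalso
        apply h
        refine Finset.mem_filter.mpr ⟨Finset.mem_univ _, ?_⟩
        intro j hj
        have : j = i := by simpa using hj
        rw [this, hc]
    by_cases h : a i = z i
    · exact hsum a b h (fun h' => hi (h.trans h'.symm)) hψ
    · have hb : b i = z i := by
        have : ∀ x y t : ZMod 2, x ≠ y → x ≠ t → y = t := by decide
        exact this _ _ _ hi h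
      exact hsum b a hb h (fun w => by rw [hψ w, add_comm])
  refine ⟨key, fun z hz => ?_⟩
  have h := key z
  rw [hz] at h
  have : (0 : ℝ) < (2 : ℝ) ^ (-(l : ℝ)) := by positivity
  rw [← h, norm_zero] at this
  norm_num at this
end

section
/- Let l ≥ 1, let a, b ∈ X = (Fin l → ZMod 2), and let i : Fin l with a i ≠ b i. Let S₁, S₂ : X → X → ℝ be stochastic matrices such that S₁ x y = 0 whenever x i ≠ y i, and S₂ x y = 0 whenever x j ≠ y j for some j ≠ i. Let W = {z ∈ X : a·z = b·z}. Suppose that ((δ_a + δ_b)/2)·S₁ is the uniform distribution on X (value 2^{−l} everywhere), and that ((δ_a + δ_b)/2)·S₁·S₂ is the uniform distribution on W (value 2^{1−l} on W and 0 off W). Then δ_a·S₁·S₂ = δ_b·S₁·S₂, and both equal the uniform distribution on W. -/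
open Finset

/-- The action of a stochastic matrix on a probability distribution:
`(p·S)(y) = ∑ x, p x * S x y`. -/
def act {l : ℕ} (p : (Fin l → ZMod 2) → ℝ)
    (S : (Fin l → ZMod 2) → (Fin l → ZMod 2) → ℝ) : (Fin l → ZMod 2) → ℝ :=
  fun y => ∑ x : Fin l → ZMod 2, p x * S x y

/-- The point distribution at `a`. -/
def delta {l : ℕ} (a : Fin l → ZMod 2) : (Fin l → ZMod 2) → ℝ :=
  fun z => if z = a then 1 else 0

theorem stmt5 {l : ℕ} (hl : 1 ≤ l) (a b : Fin l → ZMod 2) (i : Fin l)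
    (hi : a i ≠ b i)
    (S₁ S₂ : (Fin l → ZMod 2) → (Fin l → ZMod 2) → ℝ)
    (hS₁nonneg : ∀ x y, 0 ≤ S₁ x y) (hS₁row : ∀ x, ∑ y : Fin l → ZMod 2, S₁ x y = 1)
    (hS₂nonneg : ∀ x y, 0 ≤ S₂ x y) (hS₂row : ∀ x, ∑ y : Fin l → ZMod 2, S₂ x y = 1)
    (hS₁block : ∀ x y, x i ≠ y i → S₁ x y = 0)
    (hS₂block : ∀ x y, (∃ j, j ≠ i ∧ x j ≠ y j) → S₂ x y = 0)
    (p : (Fin l → ZMod 2) → ℝ)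
    (hp : ∀ z, p z = (delta a z + delta b z) / 2)
    (hstep1 : ∀ y : Fin l → ZMod 2, act p S₁ y = (2 : ℝ) ^ (-(l : ℝ)))
    (hstep2 : ∀ y : Fin l → ZMod 2, act (act p S₁) S₂ y =
      if dotp a y = dotp b y then (2 : ℝ) ^ ((1 : ℝ) - (l : ℝ)) else 0) :
    act (act (delta a) S₁) S₂ = act (act (delta b) S₁) S₂
    ∧ (∀ y : Fin l → ZMod 2, act (act (delta a) S₁) S₂ y =
        if dotp a y = dotp b y then (2 : ℝ) ^ ((1 : ℝ) - (l : ℝ)) else 0) := by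
  have hab : ∀ x : ZMod 2, x = a i ∨ x = b i := by
    generalize a i = s at hi
    generalize b i = t at hi
    revert s t
    decide
  have key : ∀ (g : (Fin l → ZMod 2) → ℝ) (y : Fin l → ZMod 2), act g S₂ y =
      g (Function.update y i (a i)) * S₂ (Function.update y i (a i)) y
      + g (Function.update y i (b i)) * S₂ (Function.update y i (b i)) y := by
    intro g y
    have hne : Function.update y i (a i) ≠ Function.update y i (b i) := by
      intro h
      have := congrFun h i
      simp at this
      exact hi this
    unfold act
    rw [← Finset.sum_pair (f := fun x => g x * S₂ x y) hne]
    symm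
    apply Finset.sum_subset (Finset.subset_univ _)
    intro x _ hx
    simp only [Finset.mem_insert, Finset.mem_singleton, not_or] at hx
    have : S₂ x y = 0 := by
      apply hS₂block
      by_contra hcon
      push Not at hcon
      have hx' : ∀ c, x i = c → x = Function.update y i c := by
        intro c hc
        funext j
        by_cases hj : j = i
        · subst hj; simp [hc]
        · simp [hj, hcon j hj]
      rcases hab (x i) with h | h
      · exact hx.1 (hx' _ h)
      · exact hx.2 (hx' _ h)
    rw [this, mul_zero]
  have hd : ∀ (c y : Fin l → ZMod 2), act (delta c) S₁ y = S₁ c y := by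
    intro c y
    simp [act, delta]
  have hpp : ∀ y, act p S₁ y = (S₁ a y + S₁ b y) / 2 := by
    intro y
    rw [← hd a y, ← hd b y]
    unfold act
    rw [← Finset.sum_add_distrib, Finset.sum_div]
    apply Finset.sum_congr rfl
    intro x _
    rw [hp]; ring
  have hu : (0 : ℝ) < (2 : ℝ) ^ (-(l : ℝ)) := by positivity
  have h2u : (2 : ℝ) ^ ((1 : ℝ) - (l : ℝ)) = 2 * (2 : ℝ) ^ (-(l : ℝ)) := by
    rw [sub_eq_add_neg, Real.rpow_add (by norm_num), Real.rpow_one]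
  simp only [h2u] at hstep2 ⊢
  clear h2u
  generalize (2 : ℝ) ^ (-(l : ℝ)) = u at *
  have hle : ∀ x y, S₂ x y ≤ 1 := by
    intro x y
    rw [← hS₂row x]
    exact Finset.single_le_sum (fun z _ => hS₂nonneg x z) (Finset.mem_univ y)
  have main : ∀ y, act (act (delta a) S₁) S₂ y = (if dotp a y = dotp b y then 2 * u else 0)
      ∧ act (act (delta b) S₁) S₂ y = (if dotp a y = dotp b y then 2 * u else 0) := by
    intro y
    have e := hstep2 y
    rw [key, hstep1, hstep1] at e
    rw [key, key, hd, hd, hd, hd]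
    have ea := hstep1 (Function.update y i (a i))
    have eb := hstep1 (Function.update y i (b i))
    rw [hpp] at ea eb
    have z1 : S₁ b (Function.update y i (a i)) = 0 := hS₁block _ _ (by simpa using hi.symm)
    have z2 : S₁ a (Function.update y i (b i)) = 0 := hS₁block _ _ (by simpa using hi)
    rw [z1] at ea
    rw [z2] at eb
    have ea' : S₁ a (Function.update y i (a i)) = 2 * u := by linarith
    have eb' : S₁ b (Function.update y i (b i)) = 2 * u := by linarith
    rw [z1, z2, ea', eb']
    have n1 := hS₂nonneg (Function.update y i (a i)) y
    have n2 := hS₂nonneg (Function.update y i (b i)) y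
    have l1 := hle (Function.update y i (a i)) y
    have l2 := hle (Function.update y i (b i)) y
    generalize S₂ (Function.update y i (a i)) y = s at *
    generalize S₂ (Function.update y i (b i)) y = t at *
    split_ifs at e ⊢
    · constructor <;> nlinarith
    · constructor <;> nlinarith
  exact ⟨funext fun y => (main y).1.trans (main y).2.symm, fun y => (main y).1⟩
end

section
/- Let l ≥ 1, let a, b ∈ X = (Fin l → ZMod 2), and let i : Fin l with a i ≠ b i. Let S₁, S₂, S₃ : X → X → ℝ be stochastic matrices such that S₁ x y = 0 whenever x i ≠ y i, and S₂ x y = 0 whenever x j ≠ y j for some j ≠ i. Let W = {z ∈ X : a·z = b·z}. Suppose that ((δ_a + δ_b)/2)·S₁ is the uniform distribution on X, that ((δ_a + δ_b)/2)·S₁·S₂ is the uniform distribution on W (value 2^{1−l} on W and 0 off W), and that ((δ_a + δ_b)/2)·S₁·S₂·S₃ = (δ_a + δ_b)/2. Then (δ_a·S₁·S₂·S₃)(b) = 1/2 and (δ_b·S₁·S₂·S₃)(a) = 1/2; i.e., a hidden variable started at a ends at b with probability exactly 1/2, and vice versa. -/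
open Finset

theorem z2_ne {u v w : ZMod 2} (h : u ≠ v) (h' : w ≠ v) : u = w := by
  revert u v w; decide

theorem dotp_flip {l : ℕ} (a b y z : Fin l → ZMod 2) (i : Fin l) (hi : a i ≠ b i)
    (hz : ∀ j, j ≠ i → z j = y j) (hzi : z i ≠ y i) (h : dotp a y = dotp b y) :
    dotp a z ≠ dotp b z := by
  have key : ∀ c : Fin l → ZMod 2, dotp c z = dotp c y + c i := by
    intro c
    unfold dotp
    rw [← Finset.add_sum_erase _ _ (Finset.mem_univ i),
      ← Finset.add_sum_erase _ (fun j => c j * y j) (Finset.mem_univ i)]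
    have : ∑ j ∈ Finset.univ.erase i, c j * z j = ∑ j ∈ Finset.univ.erase i, c j * y j := by
      apply Finset.sum_congr rfl
      intro j hj
      rw [hz j (Finset.ne_of_mem_erase hj)]
    rw [this]
    have h2 : ∀ u v w : ZMod 2, v ≠ w → u * v = u * w + u := by decide
    simp only [h2 (c i) _ _ hzi]
    ring
  rw [key, key, h]
  intro h3
  exact hi (add_left_cancel h3)

theorem stmt6 {l : ℕ} (hl : 1 ≤ l) (a b : Fin l → ZMod 2) (i : Fin l)
    (hi : a i ≠ b i)
    (S₁ S₂ S₃ : (Fin l → ZMod 2) → (Fin l → ZMod 2) → ℝ)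
    (hS₁nonneg : ∀ x y, 0 ≤ S₁ x y) (hS₁row : ∀ x, ∑ y : Fin l → ZMod 2, S₁ x y = 1)
    (hS₂nonneg : ∀ x y, 0 ≤ S₂ x y) (hS₂row : ∀ x, ∑ y : Fin l → ZMod 2, S₂ x y = 1)
    (hS₃nonneg : ∀ x y, 0 ≤ S₃ x y) (hS₃row : ∀ x, ∑ y : Fin l → ZMod 2, S₃ x y = 1)
    (hS₁block : ∀ x y, x i ≠ y i → S₁ x y = 0)
    (hS₂block : ∀ x y, (∃ j, j ≠ i ∧ x j ≠ y j) → S₂ x y = 0)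
    (p : (Fin l → ZMod 2) → ℝ)
    (hp : ∀ z, p z = (delta a z + delta b z) / 2)
    (hstep1 : ∀ y : Fin l → ZMod 2, act p S₁ y = (2 : ℝ) ^ (-(l : ℝ)))
    (hstep2 : ∀ y : Fin l → ZMod 2, act (act p S₁) S₂ y =
      if dotp a y = dotp b y then (2 : ℝ) ^ ((1 : ℝ) - (l : ℝ)) else 0)
    (hstep3 : act (act (act p S₁) S₂) S₃ = p) :
    act (act (act (delta a) S₁) S₂) S₃ b = 1 / 2
    ∧ act (act (act (delta b) S₁) S₂) S₃ a = 1 / 2 := by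
  classical
  have hact : ∀ (c : Fin l → ZMod 2) (S : (Fin l → ZMod 2) → (Fin l → ZMod 2) → ℝ),
      act (delta c) S = S c := by
    intro c S; funext y; simp [act, delta]
  have hactp : ∀ (S : (Fin l → ZMod 2) → (Fin l → ZMod 2) → ℝ) y,
      act p S y = (S a y + S b y) / 2 := by
    intro S y
    have h1 := congrFun (hact a S) y
    have h2 := congrFun (hact b S) y
    rw [← h1, ← h2]
    simp only [act]
    rw [← Finset.sum_add_distrib, Finset.sum_div]
    apply Finset.sum_congr rfl
    intro x _
    rw [hp]; ring
  set c : ℝ := (2 : ℝ) ^ (-(l : ℝ)) with hc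
  have hcpos : 0 < c := by positivity
  have hsum : ∀ y, S₁ a y + S₁ b y = 2 * c := by
    intro y; have := hstep1 y; rw [hactp] at this; linarith
  have hoff : ∀ x y, dotp a y ≠ dotp b y → S₂ x y = 0 := by
    intro x y hy
    have h := hstep2 y
    rw [if_neg hy] at h
    simp only [act] at h hstep1
    simp only [hstep1] at h
    have h' := (Finset.sum_eq_zero_iff_of_nonneg
      (fun x _ => mul_nonneg hcpos.le (hS₂nonneg x y))).1 h x (Finset.mem_univ x)
    exact (mul_eq_zero.1 h').resolve_left hcpos.ne'
  have hon : ∀ x y, dotp a y = dotp b y → (∀ j, j ≠ i → x j = y j) → S₂ x y = 1 := by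
    intro x y hy hxy
    rw [← hS₂row x]
    symm
    apply Finset.sum_eq_single y
    · intro z _ hzy
      by_cases hz : ∀ j, j ≠ i → z j = y j
      · apply hoff
        refine dotp_flip a b y z i hi hz ?_ hy
        intro hzi
        apply hzy
        funext j
        by_cases hj : j = i
        · rw [hj, hzi]
        · exact hz j hj
      · push Not at hz
        obtain ⟨j, hj, hne⟩ := hz
        exact hS₂block x z ⟨j, hj, by rw [hxy j hj]; exact hne.symm⟩
    · intro h; exact absurd (Finset.mem_univ y) h
  let e : (Fin l → ZMod 2) → (Fin l → ZMod 2) := fun x => Function.update x i (x i + 1)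
  have hei : ∀ x, e x i = x i + 1 := by intro x; simp [e]
  have hej : ∀ x j, j ≠ i → e x j = x j := by intro x j hj; simp [e, hj]
  have hinv : Function.Involutive e := by
    intro x
    funext j
    by_cases hj : j = i
    · subst hj
      rw [hei, hei]
      generalize x j = u
      revert u; decide
    · rw [hej _ _ hj, hej _ _ hj]
  have hS₂e : ∀ x y, S₂ (e x) y = S₂ x y := by
    intro x y
    by_cases hy : dotp a y = dotp b y
    · by_cases hxy : ∀ j, j ≠ i → x j = y j
      · rw [hon x y hy hxy, hon (e x) y hy (fun j hj => by rw [hej x j hj, hxy j hj])]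
      · push Not at hxy
        obtain ⟨j, hj, hne⟩ := hxy
        rw [hS₂block x y ⟨j, hj, hne⟩,
          hS₂block (e x) y ⟨j, hj, by rw [hej x j hj]; exact hne⟩]
    · rw [hoff _ _ hy, hoff _ _ hy]
  have hne1 : ∀ u : ZMod 2, u + 1 ≠ u := by decide
  have hS₁e : ∀ x, S₁ a (e x) = S₁ b x := by
    intro x
    by_cases hx : x i = a i
    · rw [hS₁block a (e x) (by rw [hei, hx]; exact (hne1 _).symm),
        hS₁block b x (by rw [hx]; exact hi.symm)]
    · have h1 := hsum x
      rw [hS₁block a x (fun h => hx h.symm)] at h1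
      have h2 := hsum (e x)
      have hxb : x i = b i := z2_ne hx hi.symm
      rw [hS₁block b (e x) (by rw [hei, hxb]; exact (hne1 _).symm)] at h2
      linarith
  have heq : act (S₁ a) S₂ = act (S₁ b) S₂ := by
    funext y
    simp only [act]
    rw [← Equiv.sum_comp hinv.toPerm]
    apply Finset.sum_congr rfl
    intro x _
    show S₁ a (e x) * S₂ (e x) y = _
    rw [hS₁e, hS₂e]
  have heqp : act (act p S₁) S₂ = act (S₁ a) S₂ := by
    funext y
    have h1 : act (act p S₁) S₂ y = (act (S₁ a) S₂ y + act (S₁ b) S₂ y) / 2 := by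
      simp only [act]
      rw [← Finset.sum_add_distrib, Finset.sum_div]
      apply Finset.sum_congr rfl
      intro x _
      have := hactp S₁ x
      simp only [act] at this
      rw [this]; ring
    rw [h1, ← heq]; ring
  have hab : a ≠ b := fun h => hi (by rw [h])
  rw [heqp] at hstep3
  rw [hact, hact, ← heq, hstep3, hp, hp]
  simp [delta, hab, hab.symm]
end

section
/- Valiant–Vazirani isolation: let n, k be natural numbers with k ≥ 2, and let A be a finite set of vectors in (Fin n → ZMod 2) with 2^{k−2} ≤ |A| ≤ 2^{k−1}. Fix s ∈ (Fin k → ZMod 2). Then the number of pairs (M, c), where M is a k×n matrix over ZMod 2 and c ∈ (Fin k → ZMod 2), such that there is exactly one x ∈ A with M·x + c = s, is at least (1/8)·2^{kn+k}, i.e., a uniformly random affine map isolates a unique element of A in the fiber of s with probability at least 1/8. -/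
theorem vv_single {n k : ℕ} (s : Fin k → ZMod 2) (x : Fin n → ZMod 2) :
    (Finset.univ.filter (fun p : Matrix (Fin k) (Fin n) (ZMod 2) × (Fin k → ZMod 2) =>
      p.1.mulVec x + p.2 = s)).card = 2 ^ (k * n) := by
  have h : Fintype.card (Matrix (Fin k) (Fin n) (ZMod 2)) = 2 ^ (k * n) := by
    rw [Fintype.card_congr (Matrix.of (m := Fin k) (n := Fin n) (α := ZMod 2)).symm]
    simp [ZMod.card, ← pow_mul, mul_comm]
  rw [← h, ← Finset.card_univ]
  symm
  refine Finset.card_bij (fun M _ => (M, s - M.mulVec x)) ?_ ?_ ?_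
  · intro M _
    simp
  · intro M _ M' _ h
    exact (Prod.ext_iff.1 h).1
  · rintro ⟨M, c⟩ hp
    simp only [Finset.mem_filter, Finset.mem_univ, true_and] at hp
    exact ⟨M, Finset.mem_univ _, by simp [← hp]⟩

theorem vv_pair {n k : ℕ} (s : Fin k → ZMod 2) (x y : Fin n → ZMod 2) (hxy : x ≠ y) :
    (Finset.univ.filter (fun p : Matrix (Fin k) (Fin n) (ZMod 2) × (Fin k → ZMod 2) =>
      p.1.mulVec x + p.2 = s ∧ p.1.mulVec y + p.2 = s)).card * 2 ^ k ≤ 2 ^ (k * n) := by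
  have h : Fintype.card (Matrix (Fin k) (Fin n) (ZMod 2)) = 2 ^ (k * n) := by
    rw [Fintype.card_congr (Matrix.of (m := Fin k) (n := Fin n) (α := ZMod 2)).symm]
    simp [ZMod.card, ← pow_mul, mul_comm]
  have hv : (Finset.univ : Finset (Fin k → ZMod 2)).card = 2 ^ k := by
    simp [ZMod.card]
  obtain ⟨i, hi⟩ : ∃ i, x i - y i ≠ 0 := by
    by_contra hc
    push Not at hc
    exact hxy (funext fun i => sub_eq_zero.1 (hc i))
  rw [← h, ← Finset.card_univ, ← hv, ← Finset.card_product]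
  have key : ∀ (M : Matrix (Fin k) (Fin n) (ZMod 2)) (c v : Fin k → ZMod 2),
      M.mulVec x + c = s → M.mulVec y + c = s →
      (M + Matrix.vecMulVec v (Pi.single i 1)).mulVec (x - y) = (x i - y i) • v := by
    intro M c v h1 h2
    have h0 : M.mulVec (x - y) = 0 := by
      rw [Matrix.mulVec_sub, sub_eq_zero]
      exact add_right_cancel (h1.trans h2.symm)
    rw [Matrix.add_mulVec, h0, zero_add]
    ext j
    simp [Matrix.vecMulVec_mulVec, mul_comm]
  refine Finset.card_le_card_of_injOn
    (fun q => q.1.1 + Matrix.vecMulVec q.2 (Pi.single i 1)) (fun _ _ => Finset.mem_coe.2 (Finset.mem_univ _)) ?_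
  rintro ⟨⟨M, c⟩, v⟩ hp ⟨⟨M', c'⟩, v'⟩ hp' heq
  simp only [Finset.coe_product, Set.mem_prod, Finset.mem_coe, Finset.mem_filter,
    Finset.mem_univ, true_and, and_true] at hp hp'
  simp only at heq
  have e1 := key M c v hp.1 hp.2
  have e2 := key M' c' v' hp'.1 hp'.2
  rw [heq, e2] at e1
  have hvv : v' = v := smul_right_injective _ hi e1
  subst hvv
  have hM : M = M' := add_right_cancel heq
  subst hM
  have hc : c = c' := add_left_cancel (hp.1.trans hp'.1.symm)
  subst hc
  rfl

theorem stmt9 {n k : ℕ} (hk : 2 ≤ k) (A : Finset (Fin n → ZMod 2))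
    (hlo : 2 ^ (k - 2) ≤ A.card) (hhi : A.card ≤ 2 ^ (k - 1))
    (s : Fin k → ZMod 2) :
    ((1 : ℝ) / 8) * 2 ^ (k * n + k) ≤
      (Nat.card {p : Matrix (Fin k) (Fin n) (ZMod 2) × (Fin k → ZMod 2) //
        ∃! x : Fin n → ZMod 2, x ∈ A ∧ p.1.mulVec x + p.2 = s} : ℝ) := by
  classical
  rw [Nat.card_eq_fintype_card, Fintype.card_subtype]
  let Q : Matrix (Fin k) (Fin n) (ZMod 2) × (Fin k → ZMod 2) → (Fin n → ZMod 2) → Prop :=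
    fun p x => p.1.mulVec x + p.2 = s
  let X : Matrix (Fin k) (Fin n) (ZMod 2) × (Fin k → ZMod 2) → ℝ :=
    fun p => ∑ x ∈ A, if Q p x then 1 else 0
  have hX : ∀ p, X p = ((A.filter (Q p)).card : ℝ) := by
    intro p; exact Finset.sum_boole _ _
  have h1 : ∑ p, (2 * X p - X p * X p) ≤
      ((Finset.univ.filter (fun p : Matrix (Fin k) (Fin n) (ZMod 2) × (Fin k → ZMod 2) =>
        ∃! x : Fin n → ZMod 2, x ∈ A ∧ p.1.mulVec x + p.2 = s)).card : ℝ) := by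
    rw [Finset.card_filter]
    push_cast
    refine Finset.sum_le_sum fun p _ => ?_
    have hiff : (∃! x : Fin n → ZMod 2, x ∈ A ∧ p.1.mulVec x + p.2 = s) ↔
        (A.filter (Q p)).card = 1 := by
      rw [Finset.card_eq_one, Finset.singleton_iff_unique_mem]
      simp [Q]
    rw [hX]
    simp only [hiff]
    split_ifs with hc
    · rw [hc]; norm_num
    · rcases Nat.lt_or_ge (A.filter (Q p)).card 1 with h | h
      · have : (A.filter (Q p)).card = 0 := by omega
        rw [this]; norm_num
      · have : 2 ≤ (A.filter (Q p)).card := by omega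
        have : (2 : ℝ) ≤ (A.filter (Q p)).card := by exact_mod_cast this
        nlinarith
  refine le_trans ?_ h1
  have hS1 : ∑ p, X p = A.card * 2 ^ (k * n) := by
    simp only [X]
    rw [Finset.sum_comm]
    rw [Finset.sum_congr rfl (g := fun _ => (2 : ℝ) ^ (k * n))]
    · simp
    · intro x _
      rw [Finset.sum_boole]
      exact_mod_cast vv_single s x
  have hS2 : ∑ p, X p * X p ≤
      A.card * (2 ^ (k * n) + A.card * (2 ^ (k * n) / 2 ^ k)) := by
    simp only [X, Finset.sum_mul_sum]
    rw [Finset.sum_comm]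
    rw [← nsmul_eq_mul]
    refine Finset.sum_le_card_nsmul _ _ _ fun x hx => ?_
    rw [Finset.sum_comm, ← Finset.add_sum_erase _ _ hx]
    refine add_le_add ?_ ?_
    · have h2 : ∑ p, ((if Q p x then (1 : ℝ) else 0) * (if Q p x then 1 else 0)) =
          ((Finset.univ.filter (fun p => Q p x)).card : ℝ) := by
        rw [← Finset.sum_boole]
        refine Finset.sum_congr rfl fun p _ => ?_
        by_cases a : Q p x <;> simp [a]
      rw [h2]
      exact_mod_cast (vv_single s x).le
    · refine (Finset.sum_le_card_nsmul (A.erase x) _ ((2 : ℝ) ^ (k * n) / 2 ^ k) ?_).trans ?_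
      · intro y hy
        have hne : x ≠ y := (Finset.ne_of_mem_erase hy).symm
        rw [le_div_iff₀ (by positivity)]
        have := vv_pair s x y hne
        have h2 : ∑ p, ((if Q p x then (1 : ℝ) else 0) * (if Q p y then 1 else 0)) =
            ((Finset.univ.filter (fun p => Q p x ∧ Q p y)).card : ℝ) := by
          rw [← Finset.sum_boole]
          refine Finset.sum_congr rfl fun p _ => ?_
          by_cases a : Q p x <;> by_cases b : Q p y <;> simp [a, b]
        rw [h2]
        exact_mod_cast this
      · rw [nsmul_eq_mul]
        gcongr
        exact Finset.erase_subset _ _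
  rw [Finset.sum_sub_distrib, ← Finset.mul_sum, hS1]
  obtain ⟨j, rfl⟩ : ∃ j, k = j + 2 := ⟨k - 2, by omega⟩
  have e1 : j + 2 - 2 = j := by omega
  have e2 : j + 2 - 1 = j + 1 := by omega
  rw [e1] at hlo
  rw [e2] at hhi
  have hlo' : (2 : ℝ) ^ j ≤ A.card := by exact_mod_cast hlo
  have hhi' : (A.card : ℝ) ≤ 2 * 2 ^ j := by
    rw [pow_succ] at hhi
    have : (A.card : ℝ) ≤ 2 ^ j * 2 := by exact_mod_cast hhi
    linarith
  refine le_trans ?_ (sub_le_sub_left hS2 _)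
  rw [pow_add 2 ((j + 2) * n), pow_add 2 j 2]
  have hN : (0 : ℝ) < 2 ^ ((j + 2) * n) := by positivity
  have ha : (0 : ℝ) < 2 ^ j := by positivity
  clear hS1 hS2 h1
  generalize (2 : ℝ) ^ ((j + 2) * n) = N at *
  generalize (2 : ℝ) ^ j = a at *
  generalize (A.card : ℝ) = m at *
  have hq : m * (N / (a * 2 ^ 2)) ≤ N / 2 := by
    rw [mul_div_assoc', div_le_div_iff₀ (by positivity) (by norm_num)]
    nlinarith
  have hm : 0 ≤ m := by linarith
  have h3 := mul_le_mul_of_nonneg_left hq hm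
  have h4 := mul_le_mul_of_nonneg_right hlo' hN.le
  nlinarith
end

section
/- Let n, k be natural numbers with k ≥ 2, and let A be a finite set of vectors in (Fin n → ZMod 2) with 2^{k−2} ≤ |A| ≤ 2^{k−1}. Then the sum, over all pairs (M, c) with M a k×n matrix over ZMod 2 and c ∈ (Fin k → ZMod 2), of the number of targets s ∈ (Fin k → ZMod 2) for which exactly one x ∈ A satisfies M·x + c = s, is at least (2^k/8)·2^{kn+k}; i.e., for a uniformly random affine map, the expected number of fibers containing exactly one element of A is at least 2^k/8. -/
open scoped Classical

lemma aux_pt {n k : ℕ} (A : Finset (Fin n → ZMod 2))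
    (p : Matrix (Fin k) (Fin n) (ZMod 2) × (Fin k → ZMod 2)) :
    A.card ≤ (Finset.univ.filter (fun s : Fin k → ZMod 2 =>
          ∃! x : Fin n → ZMod 2, x ∈ A ∧ p.1.mulVec x + p.2 = s)).card +
      (A.offDiag.filter (fun q => p.1.mulVec q.1 = p.1.mulVec q.2)).card := by
  rw [← Finset.card_filter_add_card_filter_not (s := A)
    (fun x => ∀ y ∈ A, p.1.mulVec y = p.1.mulVec x → y = x)]
  apply add_le_add
  · apply Finset.card_le_card_of_injOn (fun x => p.1.mulVec x + p.2)
    · intro x hx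
      simp only [Finset.coe_filter, Set.mem_setOf_eq, Finset.mem_univ, true_and] at hx ⊢
      refine ⟨x, ⟨hx.1, rfl⟩, ?_⟩
      rintro y ⟨hy, h⟩
      exact hx.2 y hy (add_right_cancel h)
    · intro x hx y hy h
      simp only [Finset.coe_filter, Set.mem_setOf_eq] at hx hy
      exact hy.2 x hx.1 (add_right_cancel h)
  · refine le_trans (Finset.card_le_card ?_) (Finset.card_image_le (f := Prod.fst))
    intro x hx
    simp only [Finset.mem_filter] at hx
    obtain ⟨hx, h⟩ := hx
    push Not at h
    obtain ⟨y, hy, h1, h2⟩ := h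
    refine Finset.mem_image.2 ⟨(x, y), ?_, rfl⟩
    simp only [Finset.mem_filter, Finset.mem_offDiag]
    exact ⟨⟨hx, hy, h2.symm⟩, h1.symm⟩

lemma aux_count {n k : ℕ} (x y : Fin n → ZMod 2) (h : x ≠ y) :
    (Finset.univ.filter (fun p : Matrix (Fin k) (Fin n) (ZMod 2) × (Fin k → ZMod 2) =>
      p.1.mulVec x = p.1.mulVec y)).card * 2 ^ k = 2 ^ (k * n + k) := by
  let f : Matrix (Fin k) (Fin n) (ZMod 2) × (Fin k → ZMod 2) →+ (Fin k → ZMod 2) :=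
    { toFun := fun p => p.1.mulVec (x - y)
      map_zero' := by simp
      map_add' := fun a b => by simp [Matrix.add_mulVec] }
  have hs : Function.Surjective f := by
    obtain ⟨i, hi⟩ := Function.ne_iff.1 h
    have hi' : x i - y i ≠ 0 := sub_ne_zero.2 hi
    intro v
    refine ⟨(Matrix.of fun a j => if j = i then v a * (x i - y i)⁻¹ else 0, 0), ?_⟩
    ext a
    show ∑ j, (if j = i then v a * (x i - y i)⁻¹ else 0) * (x j - y j) = v a
    simp [ite_mul, hi']
  have h1 := f.ker.card_mul_index
  rw [AddSubgroup.index_ker, AddMonoidHom.range_eq_top.2 hs] at h1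
  have h2 : Nat.card f.ker = (Finset.univ.filter
      (fun p : Matrix (Fin k) (Fin n) (ZMod 2) × (Fin k → ZMod 2) =>
      p.1.mulVec x = p.1.mulVec y)).card := by
    rw [← Nat.subtype_card (p := fun p => p ∈ f.ker)]
    intro p
    simp only [Finset.mem_filter, Finset.mem_univ, true_and, AddMonoidHom.mem_ker]
    show _ ↔ p.1.mulVec (x - y) = 0
    rw [Matrix.mulVec_sub, sub_eq_zero]
  rw [h2] at h1
  have h3 : Nat.card (⊤ : AddSubgroup (Fin k → ZMod 2)) = 2 ^ k := by simp
  have h4 : Nat.card (Matrix (Fin k) (Fin n) (ZMod 2) × (Fin k → ZMod 2)) = 2 ^ (k*n+k) := by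
    simp [Nat.card_prod, Matrix, pow_add, pow_mul', pow_right_comm]
  rw [h3, h4] at h1
  exact h1

theorem stmt10 {n k : ℕ} (hk : 2 ≤ k) (A : Finset (Fin n → ZMod 2))
    (hlo : 2 ^ (k - 2) ≤ A.card) (hhi : A.card ≤ 2 ^ (k - 1)) :
    ((2 : ℝ) ^ k / 8) * 2 ^ (k * n + k) ≤
      ∑ p : Matrix (Fin k) (Fin n) (ZMod 2) × (Fin k → ZMod 2),
        ((Finset.univ.filter (fun s : Fin k → ZMod 2 =>
          ∃! x : Fin n → ZMod 2, x ∈ A ∧ p.1.mulVec x + p.2 = s)).card : ℝ) := by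
  have h1 := Finset.sum_le_sum (fun p (_ : p ∈ (Finset.univ :
    Finset (Matrix (Fin k) (Fin n) (ZMod 2) × (Fin k → ZMod 2)))) => aux_pt A p)
  rw [Finset.sum_add_distrib] at h1
  have hT : (Finset.univ : Finset (Matrix (Fin k) (Fin n) (ZMod 2) × (Fin k → ZMod 2))).card
      = 2 ^ (k*n+k) := by
    rw [Finset.card_univ, ← Nat.card_eq_fintype_card]
    simp [Nat.card_prod, Matrix, pow_add, pow_mul', pow_right_comm]
  rw [Finset.sum_const, hT, smul_eq_mul] at h1
  have h2 : (∑ p : Matrix (Fin k) (Fin n) (ZMod 2) × (Fin k → ZMod 2),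
      (A.offDiag.filter (fun q => p.1.mulVec q.1 = p.1.mulVec q.2)).card) * 2 ^ k
      = A.offDiag.card * 2 ^ (k*n+k) := by
    simp_rw [Finset.card_filter]
    rw [Finset.sum_comm]
    simp_rw [← Finset.card_filter]
    rw [Finset.sum_mul, ← smul_eq_mul, ← Finset.sum_const]
    apply Finset.sum_congr rfl
    intro q hq
    exact aux_count q.1 q.2 (Finset.mem_offDiag.1 hq).2.2
  have h3 : A.offDiag.card ≤ A.card * 2 ^ (k-1) := by
    rw [Finset.offDiag_card]
    exact (Nat.sub_le _ _).trans (Nat.mul_le_mul_left _ hhi)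
  rw [← Nat.cast_sum]
  generalize (∑ p : Matrix (Fin k) (Fin n) (ZMod 2) × (Fin k → ZMod 2),
      (A.offDiag.filter (fun q => p.1.mulVec q.1 = p.1.mulVec q.2)).card) = C at h1 h2
  generalize (∑ p : Matrix (Fin k) (Fin n) (ZMod 2) × (Fin k → ZMod 2),
      (Finset.univ.filter (fun s : Fin k → ZMod 2 =>
          ∃! x : Fin n → ZMod 2, x ∈ A ∧ p.1.mulVec x + p.2 = s)).card) = N at h1 ⊢
  generalize A.offDiag.card = D at *
  generalize A.card = m at *
  obtain ⟨j, rfl⟩ : ∃ j, k = j + 2 := ⟨k - 2, by omega⟩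
  simp only [Nat.add_sub_cancel, show j + 2 - 1 = j + 1 by omega] at *
  have hT0 : 0 < 2 ^ ((j+2)*n+(j+2)) := by positivity
  have e : ((2:ℝ) ^ ((j+2)*n+(j+2))) = ((2 ^ ((j+2)*n+(j+2)) : ℕ) : ℝ) := by push_cast; rfl
  rw [e]
  generalize 2 ^ ((j+2)*n+(j+2)) = T at *
  have h4 : 2 * C ≤ m * T := by
    have : (2 * C) * 2 ^ (j+1) ≤ (m * T) * 2 ^ (j+1) := by
      calc (2 * C) * 2 ^ (j+1) = C * 2 ^ (j+2) := by ring
        _ = D * T := h2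
        _ ≤ (m * 2 ^ (j+1)) * T := Nat.mul_le_mul_right _ h3
        _ = _ := by ring
    exact Nat.le_of_mul_le_mul_right this (by positivity)
  have h5 : 2 ^ j * T ≤ m * T := Nat.mul_le_mul_right _ hlo
  have h6 : 2 ^ j * T ≤ 2 * N := by nlinarith
  have h7 : (2:ℝ) ^ j * T ≤ 2 * N := by exact_mod_cast h6
  rw [pow_add]
  linarith
end

section
/- Let n, k be natural numbers with k ≥ 2, and let A be a finite nonempty set of vectors in (Fin n → ZMod 2) with 2^{k−2} ≤ |A| ≤ 2^{k−1}. Then the number of triples (M, c, x), where M is a k×n matrix over ZMod 2, c ∈ (Fin k → ZMod 2), and x ∈ A is such that x is the unique element of A satisfying M·x' + c = M·x + c (i.e., every x' ∈ A with M·x' = M·x equals x), is at least (1/4)·2^{kn+k}·|A|; i.e., if h is a uniformly random affine map and x is uniform in A, then x is the unique element of A in its own fiber h^{-1}(h(x)) with probability at least 1/4. -/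
open Classical in
lemma aux_kernel {n k : ℕ} (v : Fin n → ZMod 2) (hv : v ≠ 0) :
    (Finset.univ.filter fun M : Matrix (Fin k) (Fin n) (ZMod 2) => M.mulVec v = 0).card * 2 ^ k
      ≤ 2 ^ (k * n) := by
  obtain ⟨i, hi⟩ : ∃ i, v i ≠ 0 := by
    by_contra! h
    exact hv (funext h)
  have h1 : (Finset.univ : Finset (Fin k → ZMod 2)).card = 2 ^ k := by
    simp [ZMod.card]
  have h2 : (Finset.univ : Finset (Matrix (Fin k) (Fin n) (ZMod 2))).card = 2 ^ (k * n) := by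
    rw [Finset.card_univ, ← Nat.card_eq_fintype_card]
    change Nat.card (Fin k → Fin n → ZMod 2) = _
    simp [ZMod.card, ← pow_mul, mul_comm]
  rw [← h1, ← h2, ← Finset.card_product]
  apply Finset.card_le_card_of_injOn
    (fun p => p.1 + Matrix.vecMulVec p.2 (Pi.single i 1)) (by intro _ _; simp)
  rintro ⟨M, w⟩ hM ⟨M', w'⟩ hM' h
  simp at hM hM' h
  have hw : w = w' := by
    have h3 := congrArg (fun N => N.mulVec v) h
    simp only [Matrix.add_mulVec, hM, hM', zero_add] at h3
    funext j
    have h4 := congrFun h3 j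
    simp [Matrix.mulVec, Matrix.vecMulVec_apply, dotProduct, mul_assoc, ← Finset.mul_sum,
      Pi.single_apply] at h4
    tauto
  subst hw
  simpa using h

open Classical in
lemma aux_good {n k : ℕ} (hk : 2 ≤ k) (A : Finset (Fin n → ZMod 2))
    (hhi : A.card ≤ 2 ^ (k - 1)) (x : Fin n → ZMod 2) :
    2 ^ (k * n) ≤ 2 * (Finset.univ.filter fun M : Matrix (Fin k) (Fin n) (ZMod 2) =>
      ∀ x' ∈ A, M.mulVec x' = M.mulVec x → x' = x).card := by
  have h2 : (Finset.univ : Finset (Matrix (Fin k) (Fin n) (ZMod 2))).card = 2 ^ (k * n) := by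
    rw [Finset.card_univ, ← Nat.card_eq_fintype_card]
    change Nat.card (Fin k → Fin n → ZMod 2) = _
    simp [ZMod.card, ← pow_mul, mul_comm]
  have h3 := Finset.card_filter_add_card_filter_not
    (s := (Finset.univ : Finset (Matrix (Fin k) (Fin n) (ZMod 2))))
    (fun M => ∀ x' ∈ A, M.mulVec x' = M.mulVec x → x' = x)
  rw [h2] at h3
  set B := (Finset.univ.filter fun M : Matrix (Fin k) (Fin n) (ZMod 2) =>
      ¬ ∀ x' ∈ A, M.mulVec x' = M.mulVec x → x' = x) with hB
  have h4 : B ⊆ (A.erase x).biUnion fun x' =>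
      Finset.univ.filter fun M : Matrix (Fin k) (Fin n) (ZMod 2) => M.mulVec (x' - x) = 0 := by
    intro M hM
    simp only [hB, Finset.mem_filter, Finset.mem_univ, true_and] at hM
    push Not at hM
    obtain ⟨x', a, b, c⟩ := hM
    simp only [Finset.mem_biUnion, Finset.mem_erase, Finset.mem_filter, Finset.mem_univ, true_and]
    exact ⟨x', ⟨c, a⟩, by rw [Matrix.mulVec_sub, b, sub_self]⟩
  have h5 : B.card * 2 ^ k ≤ A.card * 2 ^ (k * n) := by
    calc B.card * 2 ^ k ≤ (∑ x' ∈ A.erase x, (Finset.univ.filter fun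
          M : Matrix (Fin k) (Fin n) (ZMod 2) => M.mulVec (x' - x) = 0).card) * 2 ^ k :=
          Nat.mul_le_mul_right _ ((Finset.card_le_card h4).trans Finset.card_biUnion_le)
      _ ≤ ∑ x' ∈ A.erase x, 2 ^ (k * n) := by
          rw [Finset.sum_mul]
          apply Finset.sum_le_sum
          intro x' hx'
          exact aux_kernel _ (sub_ne_zero.2 (Finset.ne_of_mem_erase hx'))
      _ ≤ A.card * 2 ^ (k * n) := by
          rw [Finset.sum_const, smul_eq_mul]
          exact Nat.mul_le_mul_right _ (Finset.card_le_card (Finset.erase_subset _ _))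
  have h6 : 2 ^ k = 2 * 2 ^ (k - 1) := by
    rw [← pow_succ']; congr 1; omega
  have h7 : B.card * 2 ≤ 2 ^ (k * n) := by
    have h8 := h5.trans (Nat.mul_le_mul_right _ hhi)
    rw [h6] at h8
    have : 0 < 2 ^ (k - 1) := by positivity
    refine Nat.le_of_mul_le_mul_left ?_ this
    linarith
  omega

theorem stmt11 {n k : ℕ} (hk : 2 ≤ k) (A : Finset (Fin n → ZMod 2))
    (hne : A.Nonempty)
    (hlo : 2 ^ (k - 2) ≤ A.card) (hhi : A.card ≤ 2 ^ (k - 1)) :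
    ((1 : ℝ) / 4) * 2 ^ (k * n + k) * A.card ≤
      (Nat.card {t : Matrix (Fin k) (Fin n) (ZMod 2) × (Fin k → ZMod 2)
          × (Fin n → ZMod 2) //
        t.2.2 ∈ A ∧ ∀ x' ∈ A,
          t.1.mulVec x' + t.2.1 = t.1.mulVec t.2.2 + t.2.1 → x' = t.2.2} : ℝ) := by
  classical
  have h1 : (Finset.univ : Finset (Fin k → ZMod 2)).card = 2 ^ k := by
    simp [ZMod.card]
  rw [Nat.card_eq_fintype_card, Fintype.card_subtype]
  set T := (Finset.univ.filter fun t : Matrix (Fin k) (Fin n) (ZMod 2) × (Fin k → ZMod 2)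
          × (Fin n → ZMod 2) => t.2.2 ∈ A ∧ ∀ x' ∈ A,
          t.1.mulVec x' + t.2.1 = t.1.mulVec t.2.2 + t.2.1 → x' = t.2.2) with hT
  have key : (A.sigma fun x => (Finset.univ.filter fun M : Matrix (Fin k) (Fin n) (ZMod 2) =>
      ∀ x' ∈ A, M.mulVec x' = M.mulVec x → x' = x) ×ˢ
      (Finset.univ : Finset (Fin k → ZMod 2))).card ≤ T.card := by
    apply Finset.card_le_card_of_injOn (fun p => (p.2.1, p.2.2, p.1))
    · rintro ⟨x, M, c⟩ h
      simpa [hT] using h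
    · rintro ⟨x, M, c⟩ _ ⟨x', M', c'⟩ _ h
      simp at h
      obtain ⟨rfl, rfl, rfl⟩ := h
      rfl
  rw [Finset.card_sigma] at key
  have h2 : A.card * (2 ^ (k * n) * 2 ^ k) ≤ 2 * T.card := by
    refine le_trans ?_ (Nat.mul_le_mul_left 2 key)
    rw [Finset.mul_sum, ← smul_eq_mul, ← Finset.sum_const]
    apply Finset.sum_le_sum
    intro x _
    rw [Finset.card_product, h1, ← mul_assoc]
    exact Nat.mul_le_mul_right _ (aux_good hk A hhi x)
  have h3 : (A.card : ℝ) * (2 ^ (k * n) * 2 ^ k) ≤ 2 * T.card := by exact_mod_cast h2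
  rw [pow_add]
  have : (0 : ℝ) ≤ T.card := by positivity
  linarith
end
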